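/- Let m ≥ 3 be an odd integer and let s > 0 be real, and set ω = arcosh(1 + 1/s) (so cosh(ω) = 1 + 1/s and ω > 0). Then the Crank–Nicolson matrix satisfies ‖A_m(s)‖_∞ ≤ 1 if and only if 2·sinh((m−1)·ω/4)·sinh((m+1)·ω/4) ≤ sinh(ω/2)·sinh((m+1)·ω/2). -/

import Mathlib

open Real Matrix Filter

noncomputable section

/-- Tridiagonal 0/1 matrix with ones on the sub- and super-diagonal. -/
def triMat (m : ℕ) : Matrix (Fin m) (Fin m) ℝ :=
  fun i j => if (i : ℤ) - (j : ℤ) = 1 ∨ (j : ℤ) - (i : ℤ) = 1 then 1 else 0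

/-- Crank–Nicolson iteration matrix `A_m(s)`. -/
def cnMat (m : ℕ) (s : ℝ) : Matrix (Fin m) (Fin m) ℝ :=
  ((1 + s) • (1 : Matrix (Fin m) (Fin m) ℝ) - (s / 2) • triMat m)⁻¹ *
    ((1 - s) • (1 : Matrix (Fin m) (Fin m) ℝ) + (s / 2) • triMat m)

/-- Maximum (row-sum) norm of a square matrix: max over rows of the sum of absolute values. -/
def maxNorm {m : ℕ} (A : Matrix (Fin m) (Fin m) ℝ) : ℝ :=
  ⨆ i, ∑ j, |A i j|

/-- Chebyshev polynomials of the second kind. -/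
def polyU : ℕ → Polynomial ℝ
  | 0 => 1
  | 1 => 2 * Polynomial.X
  | n + 2 => 2 * Polynomial.X * polyU (n + 1) - polyU n

/-- Polynomials `P_n`. -/
def polyP : ℕ → Polynomial ℝ
  | 0 => -1
  | 1 => 2 * Polynomial.X - 4
  | n + 2 => 2 * Polynomial.X * polyP (n + 1) - polyP n

/-- Polynomials `C_n`. -/
def polyC : ℕ → Polynomial ℝ
  | 0 => 0
  | 1 => 4 * (Polynomial.X - 1)
  | n + 2 => 2 * Polynomial.X * polyC (n + 1) - polyC n

/-- The equation `coth(mω)·sinh(ω) = 3·cosh(ω) − 4`. -/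
def cothEq (m : ℕ) (ω : ℝ) : Prop :=
  Real.cosh (m * ω) / Real.sinh (m * ω) * Real.sinh ω = 3 * Real.cosh ω - 4

/-- The contractivity equation for odd `m`. -/
def oddEq (m : ℕ) (ω : ℝ) : Prop :=
  2 * Real.sinh (((m : ℝ) - 1) * ω / 4) * Real.sinh (((m : ℝ) + 1) * ω / 4) =
    Real.sinh (ω / 2) * Real.sinh (((m : ℝ) + 1) * ω / 2)

/-- The contractivity equation for even `m`. -/
def evenEq (m : ℕ) (ω : ℝ) : Prop :=
  Real.sinh (ω / 2) ^ 2 * Real.sinh ((m : ℝ) * ω / 2) *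
      (Real.sinh (((m : ℝ) + 2) * ω / 2) - Real.sinh ((m : ℝ) * ω / 2)) =
    Real.sinh ω * Real.sinh (((m : ℝ) + 1) * ω / 2) * Real.sinh ((m : ℝ) * ω / 4) *
      Real.sinh (((m : ℝ) - 2) * ω / 4)

/-- The product of a row of `triMat m` with samples of a function vanishing at both ends. -/
theorem sum_triMat_mul (m : ℕ) (f : ℕ → ℝ) (h0 : f 0 = 0) (h1 : f (m + 1) = 0) (i : Fin m) :
    ∑ k : Fin m, triMat m i k * f (k + 1) = f i + f (i + 2) := by
  have key : ∑ k ∈ Finset.range (m + 2),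
      (if k = (i : ℕ) then f k else 0) + ∑ k ∈ Finset.range (m + 2),
      (if k = (i : ℕ) + 2 then f k else 0) = f i + f (i + 2) := by
    rw [Finset.sum_ite_eq', Finset.sum_ite_eq', if_pos, if_pos] <;>
      (rw [Finset.mem_range]; omega)
  rw [← key, ← Finset.sum_add_distrib, Finset.sum_range_succ, Finset.sum_range_succ',
    Finset.sum_range]
  simp only [h0, h1, ite_self, add_zero]
  refine Finset.sum_congr rfl fun k _ => ?_
  unfold triMat
  split_ifs <;> first | omega | simp

/-- Rows of the implicit Crank–Nicolson matrix act as a second difference. -/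
theorem cnImplicit_row (m : ℕ) (s : ℝ) (f : ℕ → ℝ) (h0 : f 0 = 0) (h1 : f (m + 1) = 0)
    (i : Fin m) :
    ∑ k : Fin m, ((1 + s) • (1 : Matrix (Fin m) (Fin m) ℝ) - (s / 2) • triMat m) i k * f (k + 1)
      = (1 + s) * f (i + 1) - s / 2 * (f i + f (i + 2)) := by
  rw [← sum_triMat_mul m f h0 h1 i, Finset.mul_sum]
  simp only [Matrix.sub_apply, Matrix.smul_apply, smul_eq_mul, sub_mul, Finset.sum_sub_distrib,
    Matrix.one_apply, mul_ite, mul_one, mul_zero, ite_mul, zero_mul, Finset.sum_ite_eq,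
    Finset.mem_univ, if_true, mul_assoc]

/-- Discrete Green's function of the implicit Crank–Nicolson matrix of size `N - 1`. -/
def cnGreen (N : ℕ) (s ω : ℝ) (j k : ℕ) : ℝ :=
  2 / s / (sinh ω * sinh (N * ω)) * (sinh ((min j k : ℕ) * ω) * sinh ((N - (max j k : ℕ)) * ω))

theorem cnGreen_nonneg (N : ℕ) (s ω : ℝ) (hs : 0 < s) (hω : 0 < ω) (j k : ℕ) (hj : j ≤ N)
    (hk : k ≤ N) : 0 ≤ cnGreen N s ω j k := by
  have h : ((max j k : ℕ) : ℝ) ≤ N := by exact_mod_cast max_le hj hk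
  have h1 : 0 ≤ sinh ω := sinh_nonneg_iff.2 hω.le
  have h2 : 0 ≤ sinh (N * ω) := sinh_nonneg_iff.2 (by positivity)
  have h3 : 0 ≤ sinh ((min j k : ℕ) * ω) := sinh_nonneg_iff.2 (by positivity)
  have h4 : 0 ≤ sinh ((N - (max j k : ℕ)) * ω) :=
    sinh_nonneg_iff.2 (mul_nonneg (sub_nonneg.2 h) hω.le)
  unfold cnGreen
  positivity

theorem cnGreen_second_difference (N : ℕ) (hN : N ≠ 0) (s ω : ℝ) (hs : 0 < s) (hω : 0 < ω)
    (hcosh : cosh ω = 1 + 1 / s) (j i : ℕ) :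
    (1 + s) * cnGreen N s ω j (i + 1) - s / 2 * (cnGreen N s ω j i + cnGreen N s ω j (i + 2))
      = if i + 1 = j then 1 else 0 := by
  have hsc : 1 + s = s * cosh ω := by rw [hcosh]; field_simp; ring
  have hpos : sinh ω ≠ 0 := (sinh_pos_iff.2 hω).ne'
  have hposN : sinh (N * ω) ≠ 0 := (sinh_pos_iff.2 (by positivity)).ne'
  rw [hsc]
  unfold cnGreen
  rcases lt_trichotomy (i + 1) j with h | h | h
  · rw [if_neg h.ne, min_eq_right (by omega), min_eq_right (by omega), min_eq_right (by omega),
      max_eq_left (by omega), max_eq_left (by omega), max_eq_left (by omega)]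
    push_cast
    have e1 : (i : ℝ) * ω = (i + 1) * ω - ω := by ring
    have e2 : ((i : ℝ) + 2) * ω = (i + 1) * ω + ω := by ring
    rw [e1, e2, sinh_sub, sinh_add]
    ring
  · subst h
    rw [if_pos rfl, min_self, max_self, min_eq_right (by omega), min_eq_left (by omega),
      max_eq_left (by omega), max_eq_right (by omega)]
    push_cast
    have e1 : (i : ℝ) * ω = (i + 1) * ω - ω := by ring
    have e2 : ((N : ℝ) - (i + 2)) * ω = (N - (i + 1)) * ω - ω := by ring
    have e3 : (N : ℝ) * ω = (i + 1) * ω + (N - (i + 1)) * ω := by ring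
    rw [e3, sinh_add] at hposN
    rw [e1, e2, e3, sinh_sub, sinh_sub, sinh_add]
    generalize ((i : ℝ) + 1) * ω = a at *
    generalize ((N : ℝ) - (i + 1)) * ω = b at *
    field_simp
    ring
  · rw [if_neg h.ne', min_eq_left (by omega), min_eq_left (by omega), min_eq_left (by omega),
      max_eq_right (by omega), max_eq_right (by omega), max_eq_right (by omega)]
    push_cast
    have e1 : ((N : ℝ) - i) * ω = (N - (i + 1)) * ω + ω := by ring
    have e2 : ((N : ℝ) - (i + 2)) * ω = (N - (i + 1)) * ω - ω := by ring
    rw [e1, e2, sinh_sub, sinh_add]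
    ring

theorem cnImplicit_mul_green (m : ℕ) (s ω : ℝ) (hs : 0 < s) (hω : 0 < ω)
    (hcosh : cosh ω = 1 + 1 / s) :
    ((1 + s) • (1 : Matrix (Fin m) (Fin m) ℝ) - (s / 2) • triMat m) *
      Matrix.of (fun k j : Fin m => cnGreen (m + 1) s ω (j + 1) (k + 1)) = 1 := by
  ext i j
  rw [Matrix.mul_apply]
  simp only [Matrix.of_apply]
  rw [cnImplicit_row m s (cnGreen (m + 1) s ω (j + 1)), cnGreen_second_difference _ (by omega) s ω
    hs hω hcosh, Matrix.one_apply]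
  · simp [Fin.ext_iff]
  · simp [cnGreen]
  · rw [cnGreen, max_eq_right (by omega)]; simp

theorem cnGreen_row_sum (m : ℕ) (s ω : ℝ) (hs : 0 < s) (hω : 0 < ω)
    (hcosh : cosh ω = 1 + 1 / s) (i : Fin m) :
    ∑ j : Fin m, cnGreen (m + 1) s ω (j + 1) (i + 1) =
      1 - cosh (((m + 1) / 2 - (i + 1)) * ω) / cosh ((m + 1) / 2 * ω) := by
  set M := (1 + s) • (1 : Matrix (Fin m) (Fin m) ℝ) - (s / 2) • triMat m with hM
  set f : ℕ → ℝ := fun k => 1 - cosh (((m + 1) / 2 - k) * ω) / cosh ((m + 1) / 2 * ω) with hf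
  have hinv := cnImplicit_mul_green m s ω hs hω hcosh
  have hc : cosh ((m + 1) / 2 * ω) ≠ 0 := (cosh_pos _).ne'
  have hMf : M *ᵥ (fun k : Fin m => f (k + 1)) = fun _ => 1 := by
    ext k
    rw [Matrix.mulVec, dotProduct, hM, cnImplicit_row m s f]
    · simp only [hf]
      have hsc : 1 + s = s * cosh ω := by rw [hcosh]; field_simp; ring
      have e1 : (((m : ℝ) + 1) / 2 - (k : ℕ)) * ω = ((m + 1) / 2 - (k + 1)) * ω + ω := by ring
      have e2 : (((m : ℝ) + 1) / 2 - (k + 2)) * ω = ((m + 1) / 2 - (k + 1)) * ω - ω := by ring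
      push_cast
      rw [e1, e2, cosh_add, cosh_sub]
      field_simp
      linear_combination (-2 * cosh (((m : ℝ) + 1 - 2 * (k + 1)) * ω / 2)) * hsc
    · simp [hf, hc]
    · simp only [hf]
      have e : (((m : ℝ) + 1) / 2 - ((m + 1 : ℕ) : ℝ)) * ω = -((m + 1) / 2 * ω) := by
        push_cast; ring
      rw [e, cosh_neg, div_self hc, sub_self]
  have h := congrFun (congrArg (fun v => (Matrix.of
    (fun k j : Fin m => cnGreen (m + 1) s ω (j + 1) (k + 1))) *ᵥ v) hMf) i
  rw [mul_eq_one_comm] at hinv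
  simp only [Matrix.mulVec_mulVec, hM, hinv, Matrix.one_mulVec] at h
  simpa [Matrix.mulVec, dotProduct, hf] using h.symm

theorem cnMat_apply (m : ℕ) (s ω : ℝ) (hs : 0 < s) (hω : 0 < ω)
    (hcosh : cosh ω = 1 + 1 / s) (i j : Fin m) :
    cnMat m s i j = 2 * cnGreen (m + 1) s ω (j + 1) (i + 1) - if i = j then 1 else 0 := by
  have hinv := cnImplicit_mul_green m s ω hs hω hcosh
  have hsplit : (1 - s) • (1 : Matrix (Fin m) (Fin m) ℝ) + (s / 2) • triMat m
      = (2 : ℝ) • 1 - ((1 + s) • (1 : Matrix (Fin m) (Fin m) ℝ) - (s / 2) • triMat m) := by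
    module
  rw [cnMat, hsplit, Matrix.inv_eq_right_inv hinv, mul_sub, mul_eq_one_comm.1 hinv]
  simp [Matrix.one_apply]

/-- A row of the Crank–Nicolson matrix has absolute sum at most one exactly when its diagonal
Green's function entry dominates half of the corresponding row sum. -/
theorem cnMat_row_le_one_iff (m : ℕ) (s ω : ℝ) (hs : 0 < s) (hω : 0 < ω)
    (hcosh : cosh ω = 1 + 1 / s) (i : Fin m) :
    ∑ j, |cnMat m s i j| ≤ 1 ↔
      1 - cosh (((m + 1) / 2 - (i + 1)) * ω) / cosh ((m + 1) / 2 * ω) ≤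
        2 * cnGreen (m + 1) s ω (i + 1) (i + 1) := by
  have hc : 0 < cosh (((m + 1) / 2 - (i + 1)) * ω) / cosh ((m + 1) / 2 * ω) :=
    div_pos (cosh_pos _) (cosh_pos _)
  have hsum := cnGreen_row_sum m s ω hs hω hcosh i
  have habs : ∑ j, |cnMat m s i j| = 2 * ∑ j : Fin m, cnGreen (m + 1) s ω (j + 1) (i + 1)
      - 2 * cnGreen (m + 1) s ω (i + 1) (i + 1)
      + |2 * cnGreen (m + 1) s ω (i + 1) (i + 1) - 1| := by
    rw [Finset.mul_sum, ← Finset.add_sum_erase _ _ (Finset.mem_univ i),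
      ← Finset.add_sum_erase _ (fun j : Fin m => 2 * cnGreen (m + 1) s ω (j + 1) (i + 1))
        (Finset.mem_univ i), cnMat_apply m s ω hs hω hcosh, if_pos rfl]
    have : ∑ j ∈ Finset.univ.erase i, |cnMat m s i j|
        = ∑ j ∈ Finset.univ.erase i, 2 * cnGreen (m + 1) s ω (j + 1) (i + 1) := by
      refine Finset.sum_congr rfl fun j hj => ?_
      rw [cnMat_apply m s ω hs hω hcosh, if_neg (Finset.ne_of_mem_erase hj).symm, sub_zero,
        abs_of_nonneg]
      have := cnGreen_nonneg (m + 1) s ω hs hω (j + 1) (i + 1) (by omega) (by omega)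
      positivity
    rw [this]
    ring
  rw [habs, hsum]
  constructor <;> intro h
  · rcases abs_cases (2 * cnGreen (m + 1) s ω (i + 1) (i + 1) - 1) with h' | h' <;> linarith
  · rcases abs_cases (2 * cnGreen (m + 1) s ω (i + 1) (i + 1) - 1) with h' | h' <;> linarith

theorem cnGreen_diag_condition (m : ℕ) (s ω : ℝ) (hω : 0 < ω)
    (hcosh : cosh ω = 1 + 1 / s) (i : Fin m) :
    1 - cosh (((m + 1) / 2 - (i + 1)) * ω) / cosh ((m + 1) / 2 * ω) ≤
        2 * cnGreen (m + 1) s ω (i + 1) (i + 1) ↔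
      sinh ((m + 1) / 2 * ω) * cosh (ω / 2) ≤ 2 * sinh (ω / 2) *
        (cosh ((m + 1) / 2 * ω) + cosh (((m + 1) / 2 - (i + 1)) * ω)) := by
  set y : ℝ := (m + 1) / 2 * ω with hy
  set t : ℝ := ((m + 1) / 2 - (i + 1)) * ω with ht
  have him : ((i : ℕ) : ℝ) + 1 ≤ m := by exact_mod_cast i.2
  have hi0 : (0 : ℝ) ≤ (i : ℕ) := by positivity
  have hy0 : 0 < y := by positivity
  have hlt : cosh t < cosh y := by
    rw [cosh_lt_cosh, abs_of_pos hy0, abs_lt]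
    constructor <;> nlinarith
  have hsh : 0 < sinh (ω / 2) := sinh_pos_iff.2 (by positivity)
  have hch : 0 < cosh (ω / 2) := cosh_pos _
  have hsy : 0 < sinh y := sinh_pos_iff.2 hy0
  have hcy : 0 < cosh y := cosh_pos _
  have hω2 : ω = 2 * (ω / 2) := by ring
  have hs2 : 1 / s = 2 * sinh (ω / 2) ^ 2 := by
    have : cosh ω = cosh (ω / 2) ^ 2 + sinh (ω / 2) ^ 2 := by
      conv_lhs => rw [hω2, cosh_two_mul]
    have := cosh_sq (ω / 2)
    linarith
  have hsω : sinh ω = 2 * sinh (ω / 2) * cosh (ω / 2) := by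
    conv_lhs => rw [hω2, sinh_two_mul]
  have hprod : sinh (y - t) * sinh (y + t) = (cosh y - cosh t) * (cosh y + cosh t) := by
    rw [sinh_sub, sinh_add]
    linear_combination (-cosh t ^ 2) * cosh_sq y + cosh y ^ 2 * cosh_sq t
  have hG : 2 * cnGreen (m + 1) s ω (i + 1) (i + 1) = (cosh y - cosh t) / cosh y *
      (2 * sinh (ω / 2) * (cosh y + cosh t) / (sinh y * cosh (ω / 2))) := by
    rw [cnGreen, min_self, max_self]
    push_cast
    have e1 : ((i : ℕ) + 1 : ℝ) * ω = y - t := by rw [hy, ht]; ring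
    have e2 : ((m : ℝ) + 1 - ((i : ℕ) + 1)) * ω = y + t := by rw [hy, ht]; ring
    have e3 : ((m : ℝ) + 1) * ω = 2 * y := by rw [hy]; ring
    have e4 : 2 / s = 4 * sinh (ω / 2) ^ 2 := by
      rw [show 2 / s = 2 * (1 / s) by ring, hs2]; ring
    rw [e1, e2, e3, hprod, hsω, sinh_two_mul, e4]
    field_simp
    ring
  have hL : 1 - cosh t / cosh y = (cosh y - cosh t) / cosh y * 1 := by
    field_simp
  rw [hG, hL, mul_le_mul_iff_right₀ (div_pos (sub_pos.2 hlt) hcy), one_le_div (by positivity)]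

theorem stmt19 (m : ℕ) (hm : 3 ≤ m) (hodd : Odd m) (s : ℝ) (hs : 0 < s)
    (ω : ℝ) (hω : 0 < ω) (hcosh : Real.cosh ω = 1 + 1 / s) :
    maxNorm (cnMat m s) ≤ 1 ↔
      2 * Real.sinh (((m : ℝ) - 1) * ω / 4) * Real.sinh (((m : ℝ) + 1) * ω / 4) ≤
        Real.sinh (ω / 2) * Real.sinh (((m : ℝ) + 1) * ω / 2) := by
  have hne : Nonempty (Fin m) := ⟨⟨0, by omega⟩⟩
  have hiff : maxNorm (cnMat m s) ≤ 1 ↔ ∀ i : Fin m, sinh ((m + 1) / 2 * ω) * cosh (ω / 2) ≤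
      2 * sinh (ω / 2) * (cosh ((m + 1) / 2 * ω) + cosh (((m + 1) / 2 - (i + 1)) * ω)) := by
    rw [maxNorm, ciSup_le_iff (Set.finite_range _).bddAbove]
    exact forall_congr' fun i => (cnMat_row_le_one_iff m s ω hs hω hcosh i).trans
      (cnGreen_diag_condition m s ω hω hcosh i)
  have hmid : (∀ i : Fin m, sinh ((m + 1) / 2 * ω) * cosh (ω / 2) ≤
      2 * sinh (ω / 2) * (cosh ((m + 1) / 2 * ω) + cosh (((m + 1) / 2 - (i + 1)) * ω))) ↔
      sinh ((m + 1) / 2 * ω) * cosh (ω / 2) ≤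
        2 * sinh (ω / 2) * (cosh ((m + 1) / 2 * ω) + 1) := by
    constructor
    · intro h
      obtain ⟨k, rfl⟩ := hodd
      have hk := h ⟨k, by omega⟩
      have e : ((((2 * k + 1 : ℕ) : ℝ) + 1) / 2 - ((k : ℝ) + 1)) * ω = 0 := by push_cast; ring
      rwa [e, cosh_zero] at hk
    · intro h i
      have hsh : 0 < sinh (ω / 2) := sinh_pos_iff.2 (by positivity)
      refine h.trans ?_
      gcongr
      exact one_le_cosh _
  rw [hiff, hmid]
  set z : ℝ := ((m : ℝ) + 1) * ω / 4 with hz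
  have e1 : ((m : ℝ) + 1) / 2 * ω = 2 * z := by rw [hz]; ring
  have e2 : ((m : ℝ) - 1) * ω / 4 = z - ω / 2 := by rw [hz]; ring
  have e3 : ((m : ℝ) + 1) * ω / 2 = 2 * z := by rw [hz]; ring
  have hsz : 0 < sinh z := sinh_pos_iff.2 (by positivity)
  have hcz : 0 < cosh z := cosh_pos z
  rw [e1, e2, e3, sinh_two_mul, cosh_two_mul, sinh_sub]
  have hsq := cosh_sq z
  have hleft : 2 * sinh (ω / 2) * (cosh z ^ 2 + sinh z ^ 2 + 1)
      = 2 * cosh z * (2 * sinh (ω / 2) * cosh z) := by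
    linear_combination (-2 * sinh (ω / 2)) * hsq
  calc _ ↔ 2 * cosh z * (sinh z * cosh (ω / 2)) ≤ 2 * cosh z * (2 * sinh (ω / 2) * cosh z) := by
        rw [hleft, show 2 * sinh z * cosh z * cosh (ω / 2)
          = 2 * cosh z * (sinh z * cosh (ω / 2)) by ring]
    _ ↔ sinh z * cosh (ω / 2) ≤ 2 * sinh (ω / 2) * cosh z :=
        mul_le_mul_iff_right₀ (by positivity)
    _ ↔ sinh z * cosh (ω / 2) - cosh z * sinh (ω / 2) ≤ sinh (ω / 2) * cosh z := by
        constructor <;> intro h <;> linarith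
    _ ↔ 2 * sinh z * (sinh z * cosh (ω / 2) - cosh z * sinh (ω / 2)) ≤
          2 * sinh z * (sinh (ω / 2) * cosh z) := (mul_le_mul_iff_right₀ (by positivity)).symm
    _ ↔ _ := by
        rw [show 2 * sinh z * (sinh z * cosh (ω / 2) - cosh z * sinh (ω / 2))
          = 2 * (sinh z * cosh (ω / 2) - cosh z * sinh (ω / 2)) * sinh z by ring,
          show 2 * sinh z * (sinh (ω / 2) * cosh z)
          = sinh (ω / 2) * (2 * sinh z * cosh z) by ring]
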